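/- Let P be a probability measure on Ω = Σ^ℕ of finite evolution dimension, i.e., the linear span of the family {P∘T^{−k} : k ∈ ℕ} in the real vector space of finite signed measures on Ω is finite-dimensional. Then H̄(P) = H̲(P), i.e., the entropy rate H(P) = lim_{t→∞} H^t(P) exists. Moreover, if P̄ is a shift-invariant probability measure with ‖P_n − P̄‖_TV → 0 (the stationary mean of P), then H(P) = lim_{t→∞} H^t(P̄). -/

import Mathlib

open MeasureTheory Filter
open scoped ENNReal

variable {α : Type*}

/-- The cylinder set of sequences in `Ω = Σ^ℕ` whose first `t` symbols are `v`. -/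
def cylinder (t : ℕ) (v : Fin t → α) : Set (ℕ → α) :=
  {ω | ∀ i : Fin t, ω (i : ℕ) = v i}

variable [Fintype α] [Nonempty α] [MeasurableSpace α] [DiscreteMeasurableSpace α]

/-- `P(v)`, the probability that the source emits the word `v`. -/
noncomputable def wordProb (P : Measure (ℕ → α)) {t : ℕ} (v : Fin t → α) : ℝ :=
  (P (cylinder t v)).toReal

/-- `H^t(P)`, the entropy of the induced distribution on words of length `t`, divided
by `t` (natural logarithm; the convention `0 · log 0 = 0` holds since `Real.log 0 = 0`). -/
noncomputable def Hn (P : Measure (ℕ → α)) (t : ℕ) : ℝ :=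
  -(1 / (t : ℝ)) * ∑ v : Fin t → α, wordProb P v * Real.log (wordProb P v)

/-- `d_{TV,t}(P,Q) = Σ_{v ∈ Σ^t} |P(v) − Q(v)|`. -/
noncomputable def dTVt (P Q : Measure (ℕ → α)) (t : ℕ) : ℝ :=
  ∑ v : Fin t → α, |wordProb P v - wordProb Q v|

/-- `d_TV(P,Q) = sup_{t ∈ ℕ} d_{TV,t}(P,Q)`. -/
noncomputable def dTV (P Q : Measure (ℕ → α)) : ℝ := ⨆ t : ℕ, dTVt P Q t

/-- The shift operator `T` on `Ω = Σ^ℕ`: `T(v₀v₁v₂…) = v₁v₂…`. -/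
def shift : (ℕ → α) → (ℕ → α) := fun ω n => ω (n + 1)

/-- `P_n := (1/n) Σ_{i=0}^{n−1} P ∘ T^{−i}` (as a measure on `Ω`). -/
noncomputable def cesaroAvg (P : Measure (ℕ → α)) (n : ℕ) : Measure (ℕ → α) :=
  (n : ℝ≥0∞)⁻¹ • ∑ i ∈ Finset.range n, P.map (shift^[i])

/-- `P_n := (1/n) Σ_{i=0}^{n−1} P ∘ T^{−i}`, as a finite signed measure on `Ω`. -/
noncomputable def cesaroAvgS (P : Measure (ℕ → α)) [IsFiniteMeasure P] (n : ℕ) :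
    SignedMeasure (ℕ → α) :=
  (n : ℝ)⁻¹ • ∑ i ∈ Finset.range n, (P.toSignedMeasure).map (shift^[i])

section RealInequalities

open Real

variable {ι κ : Type*}

/-- Pointwise form of Gibbs' inequality. -/
lemma Real.negMulLog_le_neg_mul_log_add {p q : ℝ} (hp : 0 ≤ p) (hq : 0 ≤ q)
    (hpq : q = 0 → p = 0) : negMulLog p ≤ -p * log q + q - p := by
  rcases hp.eq_or_lt with rfl | hp
  · simpa using hq
  have hq' : 0 < q := hq.lt_of_ne' fun h => hp.ne' (hpq h)
  have h := mul_le_mul_of_nonneg_left (log_le_sub_one_of_pos (div_pos hq' hp)) hp.le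
  rw [log_div hq'.ne' hp.ne'] at h
  have h' : p * (q / p - 1) = q - p := by field_simp
  rw [negMulLog]
  linarith

lemma Real.negMulLog_sum_le (s : Finset ι) {p : ι → ℝ} (hp : ∀ i ∈ s, 0 ≤ p i) :
    negMulLog (∑ i ∈ s, p i) ≤ ∑ i ∈ s, negMulLog (p i) := by
  rw [negMulLog, ← Finset.sum_neg_distrib, Finset.sum_mul]
  refine Finset.sum_le_sum fun i hi => ?_
  rcases (hp i hi).eq_or_lt with h | h
  · simp [← h]
  · have := log_le_log h (Finset.single_le_sum hp hi)
    rw [negMulLog]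
    nlinarith

lemma Real.sum_negMulLog_le [Fintype ι] {p : ι → ℝ} (hp : ∀ i, 0 ≤ p i) :
    ∑ i, negMulLog (p i) ≤ negMulLog (∑ i, p i) + (∑ i, p i) * log (Fintype.card ι) := by
  cases isEmpty_or_nonempty ι
  · simp
  set S := ∑ i, p i with hS
  set N : ℝ := (Fintype.card ι : ℝ) with hN
  have hN0 : 0 < N := by simp [hN, Fintype.card_pos]
  have hS0 : 0 ≤ S := Finset.sum_nonneg fun i _ => hp i
  have key : ∀ i, negMulLog (p i) ≤ p i * (-log S + log N) + S / N - p i := by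
    intro i
    rcases hS0.eq_or_lt with h | h
    · have : p i = 0 := le_antisymm
        (h ▸ Finset.single_le_sum (fun i _ => hp i) (Finset.mem_univ i)) (hp i)
      simp [this, ← h]
    · have := negMulLog_le_neg_mul_log_add (hp i) (div_pos h hN0).le
        fun h0 => absurd h0 (div_pos h hN0).ne'
      rw [log_div h.ne' hN0.ne'] at this
      linarith
  calc ∑ i, negMulLog (p i) ≤ ∑ i, (p i * (-log S + log N) + S / N - p i) :=
        Finset.sum_le_sum fun i _ => key i
    _ = negMulLog S + S * log N := by
        rw [Finset.sum_sub_distrib, Finset.sum_add_distrib, ← Finset.sum_mul, ← hS,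
          Finset.sum_const, Finset.card_univ, nsmul_eq_mul, ← hN, negMulLog]
        field_simp
        ring

lemma Real.abs_negMulLog_sub_le {x y : ℝ} (hx : x ∈ Set.Icc (0 : ℝ) 1)
    (hy : y ∈ Set.Icc (0 : ℝ) 1) :
    |negMulLog x - negMulLog y| ≤ negMulLog |x - y| + |x - y| := by
  wlog hxy : x ≤ y generalizing x y
  · rw [abs_sub_comm, abs_sub_comm x]
    exact this hy hx (le_of_not_ge hxy)
  have hd0 : 0 ≤ y - x := by linarith
  have hd : 0 ≤ negMulLog (y - x) := negMulLog_nonneg hd0 (by linarith [hx.1, hy.2])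
  rw [abs_sub_comm x, abs_of_nonneg hd0, abs_le]
  constructor
  · have := negMulLog_sum_le (Finset.univ : Finset (Fin 2)) (p := ![x, y - x])
      (by simp [Fin.forall_fin_two, hx.1, hxy])
    simp only [Fin.sum_univ_two, Matrix.cons_val_zero, Matrix.cons_val_one,
      add_sub_cancel] at this
    linarith
  · have := negMulLog_le_neg_mul_log_add hx.1 hy.1 fun h => le_antisymm (h ▸ hxy) hx.1
    have := log_nonpos hy.1 hy.2
    rw [negMulLog_def] at *
    nlinarith

lemma Real.abs_sum_negMulLog_sub_le [Fintype ι] {p q : ι → ℝ} (hp : ∀ i, p i ∈ Set.Icc (0 : ℝ) 1)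
    (hq : ∀ i, q i ∈ Set.Icc (0 : ℝ) 1) :
    |∑ i, negMulLog (p i) - ∑ i, negMulLog (q i)| ≤
      1 + (∑ i, |p i - q i|) * log (Fintype.card ι) := by
  rw [← Finset.sum_sub_distrib]
  calc _ ≤ ∑ i, |negMulLog (p i) - negMulLog (q i)| := Finset.abs_sum_le_sum_abs _ _
    _ ≤ ∑ i, (negMulLog |p i - q i| + |p i - q i|) :=
        Finset.sum_le_sum fun i _ => abs_negMulLog_sub_le (hp i) (hq i)
    _ ≤ _ := by
        rw [Finset.sum_add_distrib]
        have h₁ := sum_negMulLog_le (p := fun i => |p i - q i|) fun i => abs_nonneg _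
        have h₂ := negMulLog_le_one_sub_self
          (Finset.sum_nonneg fun i (_ : i ∈ Finset.univ) => abs_nonneg (p i - q i))
        linarith

lemma Real.average_negMulLog_le {n : ℕ} (hn : n ≠ 0) {q : ℕ → ℝ} (hq : ∀ i, 0 ≤ q i) :
    (n : ℝ)⁻¹ * ∑ i ∈ Finset.range n, negMulLog (q i) ≤
      negMulLog ((n : ℝ)⁻¹ * ∑ i ∈ Finset.range n, q i) := by
  have := concaveOn_negMulLog.le_map_sum (t := Finset.range n) (w := fun _ => (n : ℝ)⁻¹) (p := q)
    (fun _ _ => by positivity) (by simp [hn]) (fun i _ => hq i)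
  simpa only [smul_eq_mul, ← Finset.mul_sum] using this

lemma Real.negMulLog_average_le {n : ℕ} (hn : n ≠ 0) {q : ℕ → ℝ} (hq : ∀ i, 0 ≤ q i) :
    negMulLog ((n : ℝ)⁻¹ * ∑ i ∈ Finset.range n, q i) ≤
      (n : ℝ)⁻¹ * ∑ i ∈ Finset.range n, negMulLog (q i) +
        ((n : ℝ)⁻¹ * ∑ i ∈ Finset.range n, q i) * log n := by
  have hn' : (n : ℝ) ≠ 0 := by exact_mod_cast hn
  rw [Finset.mul_sum]
  refine (negMulLog_sum_le _ fun i _ => mul_nonneg (by positivity) (hq i)).trans_eq ?_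
  rw [Finset.sum_mul, Finset.mul_sum, ← Finset.sum_add_distrib]
  refine Finset.sum_congr rfl fun i _ => ?_
  rw [negMulLog_mul, negMulLog, log_inv]
  ring

lemma Real.sum_sum_negMulLog_le_add [Fintype ι] [Fintype κ] {p : ι → κ → ℝ}
    (hp : ∀ i j, 0 ≤ p i j)
    (h1 : ∑ i, ∑ j, p i j = 1) :
    ∑ i, ∑ j, negMulLog (p i j) ≤
      ∑ i, negMulLog (∑ j, p i j) + ∑ j, negMulLog (∑ i, p i j) := by
  set a : ι → ℝ := fun i => ∑ j, p i j
  set b : κ → ℝ := fun j => ∑ i, p i j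
  have hpa : ∀ i j, p i j ≤ a i := fun i j =>
    Finset.single_le_sum (fun j _ => hp i j) (Finset.mem_univ j)
  have hpb : ∀ i j, p i j ≤ b j := fun i j =>
    Finset.single_le_sum (f := fun i => p i j) (fun i _ => hp i j) (Finset.mem_univ i)
  have hb1 : ∑ j, b j = 1 := by rw [← h1, Finset.sum_comm]
  have key : ∀ i j, negMulLog (p i j) ≤
      (-p i j * log (a i) + -p i j * log (b j)) + (a i * b j - p i j) := by
    intro i j
    rcases (hp i j).eq_or_lt with h | h
    · simpa [← h] using mul_nonneg ((hp i j).trans (hpa i j)) ((hp i j).trans (hpb i j))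
    · have hai := h.trans_le (hpa i j)
      have hbj := h.trans_le (hpb i j)
      have := negMulLog_le_neg_mul_log_add h.le (mul_pos hai hbj).le
        fun h0 => absurd h0 (mul_pos hai hbj).ne'
      rw [log_mul hai.ne' hbj.ne'] at this
      linarith
  calc ∑ i, ∑ j, negMulLog (p i j)
      ≤ ∑ i, ∑ j, ((-p i j * log (a i) + -p i j * log (b j)) + (a i * b j - p i j)) :=
        Finset.sum_le_sum fun i _ => Finset.sum_le_sum fun j _ => key i j
    _ = (∑ i, ∑ j, -p i j * log (a i) + ∑ j, ∑ i, -p i j * log (b j)) +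
          ((∑ i, a i) * ∑ j, b j - ∑ i, ∑ j, p i j) := by
        rw [Finset.sum_comm (s := (Finset.univ : Finset κ)), Finset.sum_mul_sum]
        simp only [Finset.sum_add_distrib, Finset.sum_sub_distrib]
    _ = _ := by
        rw [hb1, h1]
        simp [← Finset.sum_mul, negMulLog, a, b]

end RealInequalities

section WordEntropy

open Real

variable {β : Type*}

lemma shift_iterate_apply (k : ℕ) (ω : ℕ → β) (n : ℕ) : shift^[k] ω n = ω (k + n) := by
  induction k generalizing ω with
  | zero => simp
  | succ k ih => rw [Function.iterate_succ_apply, ih]; simp only [shift]; congr 1; omega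

lemma mem_wordCylinder {t : ℕ} {v : Fin t → β} {ω : ℕ → β} :
    ω ∈ cylinder t v ↔ ∀ i : Fin t, ω i = v i :=
  Iff.rfl

lemma cylinder_append {s t : ℕ} (u : Fin s → β) (v : Fin t → β) :
    cylinder (s + t) (Fin.append u v) = cylinder s u ∩ shift^[s] ⁻¹' cylinder t v := by
  ext ω
  simp only [Set.mem_inter_iff, Set.mem_preimage, mem_wordCylinder, shift_iterate_apply]
  constructor
  · exact fun h => ⟨fun i => by simpa using h (Fin.castAdd t i),
      fun i => by simpa using h (Fin.natAdd s i)⟩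
  · rintro ⟨h₁, h₂⟩ i
    induction i using Fin.addCases with
    | left i => simpa using h₁ i
    | right i => simpa using h₂ i

lemma log_card_words [Fintype β] (t : ℕ) :
    log (Fintype.card (Fin t → β)) = t * log (Fintype.card β) := by
  simp

variable [MeasurableSpace β]

lemma measurable_shift : Measurable (shift : (ℕ → β) → ℕ → β) :=
  measurable_pi_lambda _ fun n => measurable_pi_apply (n + 1)

lemma measurable_shift_iterate (k : ℕ) : Measurable (shift^[k] : (ℕ → β) → ℕ → β) :=
  measurable_shift.iterate k

instance isProbabilityMeasure_map_shift (P : Measure (ℕ → β)) [IsProbabilityMeasure P] (k : ℕ) :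
    IsProbabilityMeasure (P.map shift^[k]) :=
  Measure.isProbabilityMeasure_map (measurable_shift_iterate k).aemeasurable

lemma wordProb_mem_Icc (P : Measure (ℕ → β)) [IsProbabilityMeasure P] {t : ℕ} (v : Fin t → β) :
    wordProb P v ∈ Set.Icc (0 : ℝ) 1 :=
  ⟨measureReal_nonneg, measureReal_le_one⟩

/-- The unnormalized entropy of the distribution of words of length `t`. -/
noncomputable def wordEntropy [Fintype β] (P : Measure (ℕ → β)) (t : ℕ) : ℝ :=
  ∑ v : Fin t → β, negMulLog (wordProb P v)

lemma Hn_eq_wordEntropy_div [Fintype β] (P : Measure (ℕ → β)) (t : ℕ) :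
    Hn P t = wordEntropy P t / t := by
  simp only [Hn, wordEntropy, negMulLog, neg_mul, Finset.sum_neg_distrib]
  ring

lemma wordEntropy_add [Fintype β] (P : Measure (ℕ → β)) (s t : ℕ) :
    wordEntropy P (s + t) =
      ∑ u : Fin s → β, ∑ v : Fin t → β, negMulLog (wordProb P (Fin.append u v)) := by
  rw [wordEntropy, ← Fintype.sum_prod_type', ← (Fin.appendEquiv s t).sum_comp]
  rfl

lemma wordEntropy_nonneg [Fintype β] (P : Measure (ℕ → β)) [IsProbabilityMeasure P] (t : ℕ) :
    0 ≤ wordEntropy P t :=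
  Finset.sum_nonneg fun v _ =>
    negMulLog_nonneg (wordProb_mem_Icc P v).1 (wordProb_mem_Icc P v).2

variable [DiscreteMeasurableSpace β]

lemma measurableSet_wordCylinder {t : ℕ} (v : Fin t → β) : MeasurableSet (cylinder t v) := by
  have : cylinder t v = ⋂ i : Fin t, (fun ω : ℕ → β => ω i) ⁻¹' {v i} := by
    ext ω; simp [mem_wordCylinder]
  rw [this]
  exact MeasurableSet.iInter fun i => measurable_pi_apply _ (MeasurableSet.of_discrete)

lemma wordProb_map_shift (P : Measure (ℕ → β)) (k : ℕ) {t : ℕ} (v : Fin t → β) :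
    wordProb (P.map shift^[k]) v = P.real (shift^[k] ⁻¹' cylinder t v) := by
  rw [wordProb, Measure.map_apply (measurable_shift_iterate k) (measurableSet_wordCylinder v),
    Measure.real]

variable [Fintype β]

lemma sum_measureReal_inter_preimage_cylinder (μ : Measure (ℕ → β)) [IsFiniteMeasure μ]
    {A : Set (ℕ → β)} (hA : MeasurableSet A) (k t : ℕ) :
    ∑ v : Fin t → β, μ.real (A ∩ shift^[k] ⁻¹' cylinder t v) = μ.real A := by
  rw [← measureReal_biUnion_finset]
  · congr 1
    ext ω
    simp only [Finset.mem_univ, Set.iUnion_true, Set.mem_iUnion, Set.mem_inter_iff,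
      exists_and_left, and_iff_left_iff_imp]
    exact fun _ => ⟨fun i => shift^[k] ω i, fun i => rfl⟩
  · intro v _ w _ hvw
    refine Set.disjoint_left.2 fun ω hv hw => hvw ?_
    ext i
    exact (hv.2 i).symm.trans (hw.2 i)
  · exact fun v _ => hA.inter (measurable_shift_iterate k (measurableSet_wordCylinder v))

lemma sum_measureReal_preimage_cylinder (μ : Measure (ℕ → β)) [IsFiniteMeasure μ] (k t : ℕ) :
    ∑ v : Fin t → β, μ.real (shift^[k] ⁻¹' cylinder t v) = μ.real Set.univ := by
  simpa using sum_measureReal_inter_preimage_cylinder μ MeasurableSet.univ k t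

lemma sum_wordProb (P : Measure (ℕ → β)) [IsProbabilityMeasure P] (t : ℕ) :
    ∑ v : Fin t → β, wordProb P v = 1 :=
  (sum_measureReal_preimage_cylinder P 0 t).trans probReal_univ

lemma sum_wordProb_append_right (P : Measure (ℕ → β)) [IsFiniteMeasure P] {s : ℕ} (t : ℕ)
    (u : Fin s → β) : ∑ v : Fin t → β, wordProb P (Fin.append u v) = wordProb P u := by
  simp only [wordProb, cylinder_append]
  exact sum_measureReal_inter_preimage_cylinder P (measurableSet_wordCylinder u) s t

lemma sum_wordProb_append_left (P : Measure (ℕ → β)) [IsFiniteMeasure P] (s : ℕ) {t : ℕ}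
    (v : Fin t → β) :
    ∑ u : Fin s → β, wordProb P (Fin.append u v) = wordProb (P.map shift^[s]) v := by
  rw [wordProb_map_shift]
  simp only [wordProb, cylinder_append, Set.inter_comm (cylinder s _)]
  exact sum_measureReal_inter_preimage_cylinder P
    (measurable_shift_iterate s (measurableSet_wordCylinder v)) 0 s

lemma wordEntropy_le_add (P : Measure (ℕ → β)) [IsFiniteMeasure P] (s t : ℕ) :
    wordEntropy P s ≤ wordEntropy P (s + t) := by
  rw [wordEntropy_add, wordEntropy]
  refine Finset.sum_le_sum fun u _ => ?_
  rw [← sum_wordProb_append_right P t u]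
  exact negMulLog_sum_le _ fun v _ => ENNReal.toReal_nonneg

lemma wordEntropy_map_shift_le_add (P : Measure (ℕ → β)) [IsFiniteMeasure P] (s t : ℕ) :
    wordEntropy (P.map shift^[s]) t ≤ wordEntropy P (s + t) := by
  rw [wordEntropy_add, wordEntropy, Finset.sum_comm]
  refine Finset.sum_le_sum fun v _ => ?_
  rw [← sum_wordProb_append_left P s v]
  exact negMulLog_sum_le _ fun v _ => ENNReal.toReal_nonneg

variable (P : Measure (ℕ → β)) [IsProbabilityMeasure P]

lemma wordEntropy_add_le_left (s t : ℕ) :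
    wordEntropy P (s + t) ≤ wordEntropy P s + t * log (Fintype.card β) := by
  calc wordEntropy P (s + t)
      ≤ ∑ u : Fin s → β, (negMulLog (wordProb P u) +
          wordProb P u * log (Fintype.card (Fin t → β))) := by
        rw [wordEntropy_add]
        refine Finset.sum_le_sum fun u _ => ?_
        rw [← sum_wordProb_append_right P t u]
        exact sum_negMulLog_le fun v => ENNReal.toReal_nonneg
    _ = _ := by
        rw [Finset.sum_add_distrib, ← Finset.sum_mul, sum_wordProb, one_mul, log_card_words,
          wordEntropy]

lemma wordEntropy_add_le_right (s t : ℕ) :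
    wordEntropy P (s + t) ≤ wordEntropy (P.map shift^[s]) t + s * log (Fintype.card β) := by
  calc wordEntropy P (s + t)
      ≤ ∑ v : Fin t → β, (negMulLog (wordProb (P.map shift^[s]) v) +
          wordProb (P.map shift^[s]) v * log (Fintype.card (Fin s → β))) := by
        rw [wordEntropy_add, Finset.sum_comm]
        refine Finset.sum_le_sum fun v _ => ?_
        rw [← sum_wordProb_append_left P s v]
        exact sum_negMulLog_le fun u => ENNReal.toReal_nonneg
    _ = _ := by
        rw [Finset.sum_add_distrib, ← Finset.sum_mul, sum_wordProb, one_mul, log_card_words,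
          wordEntropy]

lemma wordEntropy_add_le (s t : ℕ) :
    wordEntropy P (s + t) ≤ wordEntropy P s + wordEntropy (P.map shift^[s]) t := by
  have h := sum_sum_negMulLog_le_add
    (p := fun (u : Fin s → β) (v : Fin t → β) => wordProb P (Fin.append u v))
    (fun u v => ENNReal.toReal_nonneg)
    (by simp only [sum_wordProb_append_right, sum_wordProb])
  simp only [sum_wordProb_append_right, sum_wordProb_append_left] at h
  rwa [wordEntropy_add]

lemma abs_wordEntropy_map_shift_sub_le (k t : ℕ) :
    |wordEntropy (P.map shift^[k]) t - wordEntropy P t| ≤ k * log (Fintype.card β) := by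
  have h₁ := wordEntropy_le_add P t k
  have h₂ := wordEntropy_add_le_left P t k
  have h₃ := wordEntropy_map_shift_le_add P k t
  have h₄ := wordEntropy_add_le_right P k t
  rw [add_comm k t] at h₃ h₄
  rw [abs_le]
  constructor <;> linarith

lemma exists_tendsto_Hn_of_map_shift_eq (hP : P.map shift = P) :
    ∃ L : ℝ, Tendsto (Hn P) atTop (nhds L) := by
  have hmap : ∀ k, P.map shift^[k] = P := by
    intro k
    induction k with
    | zero => exact Measure.map_id
    | succ k ih =>
      rw [Function.iterate_succ', ← Measure.map_map measurable_shift
        (measurable_shift_iterate k), ih, hP]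
  have hsub : Subadditive (wordEntropy P) := fun s t => by
    simpa only [hmap s] using wordEntropy_add_le P s t
  refine ⟨hsub.lim, ?_⟩
  rw [funext (Hn_eq_wordEntropy_div P)]
  refine hsub.tendsto_lim ⟨0, ?_⟩
  rintro _ ⟨t, rfl⟩
  exact div_nonneg (wordEntropy_nonneg P t) (by positivity)

/-- Averaging the first `n` shifts of `P` changes the entropy of words of length `t` by an amount
bounded independently of `t`. -/
lemma abs_sum_negMulLog_average_sub_wordEntropy_le {n : ℕ} (hn : n ≠ 0) (t : ℕ) :
    |∑ v : Fin t → β,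
        negMulLog ((n : ℝ)⁻¹ * ∑ i ∈ Finset.range n, wordProb (P.map shift^[i]) v) -
      wordEntropy P t| ≤ n * log (Fintype.card β) + log n := by
  have hn' : (n : ℝ) ≠ 0 := by exact_mod_cast hn
  have hnonneg : ∀ (v : Fin t → β) (i : ℕ), 0 ≤ wordProb (P.map shift^[i]) v :=
    fun v i => ENNReal.toReal_nonneg
  have hcomm : ∑ v : Fin t → β,
      (n : ℝ)⁻¹ * ∑ i ∈ Finset.range n, negMulLog (wordProb (P.map shift^[i]) v) =
      (n : ℝ)⁻¹ * ∑ i ∈ Finset.range n, wordEntropy (P.map shift^[i]) t := by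
    rw [← Finset.mul_sum, Finset.sum_comm]
    rfl
  have hone : ∑ v : Fin t → β,
      (n : ℝ)⁻¹ * ∑ i ∈ Finset.range n, wordProb (P.map shift^[i]) v = 1 := by
    rw [← Finset.mul_sum, Finset.sum_comm]
    simp [sum_wordProb, hn']
  have hlower := Finset.sum_le_sum fun v (_ : v ∈ (Finset.univ : Finset (Fin t → β))) =>
    average_negMulLog_le hn (hnonneg v)
  have hupper := Finset.sum_le_sum fun v (_ : v ∈ (Finset.univ : Finset (Fin t → β))) =>
    negMulLog_average_le hn (hnonneg v)
  rw [Finset.sum_add_distrib, ← Finset.sum_mul, hone, hcomm, one_mul] at hupper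
  rw [hcomm] at hlower
  have hlog : 0 ≤ log (Fintype.card β) := log_natCast_nonneg _
  have havg : |(n : ℝ)⁻¹ * ∑ i ∈ Finset.range n, wordEntropy (P.map shift^[i]) t -
      wordEntropy P t| ≤ n * log (Fintype.card β) := by
    have : (n : ℝ)⁻¹ * ∑ i ∈ Finset.range n, wordEntropy (P.map shift^[i]) t - wordEntropy P t =
        (n : ℝ)⁻¹ *
          ∑ i ∈ Finset.range n, (wordEntropy (P.map shift^[i]) t - wordEntropy P t) := by
      rw [Finset.sum_sub_distrib, mul_sub]
      simp [hn']
    rw [this, abs_mul, abs_of_nonneg (by positivity), inv_mul_le_iff₀ (by positivity)]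
    refine (Finset.abs_sum_le_sum_abs _ _).trans ?_
    refine (Finset.sum_le_card_nsmul _ _ (n * log (Fintype.card β)) fun i hi => ?_).trans ?_
    · refine (abs_wordEntropy_map_shift_sub_le P i t).trans ?_
      have : (i : ℝ) ≤ n := by exact_mod_cast (Finset.mem_range.1 hi).le
      gcongr
    · simp
  have hlogn : 0 ≤ log n := log_natCast_nonneg _
  rw [abs_le] at *
  constructor <;> linarith

end WordEntropy

section StationaryMean

/-- If a linear map on a finite-dimensional space has no nontrivial Jordan block for the eigenvalue
`1`, every vector is the sum of a fixed vector and a coboundary. -/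
lemma LinearMap.exists_fixed_add_coboundary {K V : Type*} [Field K] [AddCommGroup V] [Module K V]
    [FiniteDimensional K V] (f : V →ₗ[K] V)
    (hf : ∀ x y : V, f x = x → x = f y - y → x = 0) (p : V) :
    ∃ x y : V, f x = x ∧ p = x + (f y - y) := by
  have hdisj : Disjoint (LinearMap.ker (f - LinearMap.id)) (LinearMap.range (f - LinearMap.id)) := by
    rw [Submodule.disjoint_def]
    rintro x hx ⟨y, hy⟩
    exact hf x y (sub_eq_zero.1 (by simpa using hx)) (by simpa using hy.symm)
  have htop := Submodule.eq_top_of_disjoint _ _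
    (by rw [add_comm, LinearMap.finrank_range_add_finrank_ker]) hdisj
  obtain ⟨x, hx, z, ⟨y, rfl⟩, h⟩ := Submodule.mem_sup.1 (htop ▸ Submodule.mem_top : p ∈ _)
  exact ⟨x, y, sub_eq_zero.1 (by simpa using hx), by simpa using h.symm⟩

variable {β : Type*} [MeasurableSpace β]

lemma signedMeasure_map_shift_iterate_succ (s : SignedMeasure (ℕ → β)) (k : ℕ) :
    (s.map shift^[k]).map shift = s.map shift^[k + 1] := by
  ext A hA
  rw [VectorMeasure.map_apply _ measurable_shift hA,
    VectorMeasure.map_apply _ (measurable_shift_iterate k) (measurable_shift hA),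
    VectorMeasure.map_apply _ (measurable_shift_iterate (k + 1)) hA, Function.iterate_succ']
  rfl

lemma abs_signedMeasure_le (s : SignedMeasure (ℕ → β)) (A : Set (ℕ → β)) :
    |s A| ≤ s.totalVariation.real Set.univ :=
  (s.norm_le_totalVariation A).trans (measureReal_mono (Set.subset_univ A))

lemma signedMeasure_preimage_shift_iterate {s : SignedMeasure (ℕ → β)} (hs : s.map shift = s)
    {A : Set (ℕ → β)} (hA : MeasurableSet A) (k : ℕ) : s (shift^[k] ⁻¹' A) = s A := by
  induction k with
  | zero => rfl
  | succ k ih =>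
    rw [Function.iterate_succ, Set.preimage_comp, ← VectorMeasure.map_apply _ measurable_shift
      (measurable_shift_iterate k hA), hs, ih]

lemma sum_apply_preimage_shift_iterate {p x y : SignedMeasure (ℕ → β)} (hx : x.map shift = x)
    (hp : p = x + (y.map shift - y)) {A : Set (ℕ → β)} (hA : MeasurableSet A) (n : ℕ) :
    ∑ i ∈ Finset.range n, p (shift^[i] ⁻¹' A) = n * x A + (y (shift^[n] ⁻¹' A) - y A) := by
  have : ∀ i, p (shift^[i] ⁻¹' A) = x A + (y (shift^[i + 1] ⁻¹' A) - y (shift^[i] ⁻¹' A)) := by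
    intro i
    rw [hp, add_apply, sub_apply,
      signedMeasure_preimage_shift_iterate hx hA,
      VectorMeasure.map_apply _ measurable_shift (measurable_shift_iterate i hA)]
    rfl
  simp only [this, Finset.sum_add_distrib, Finset.sum_const, Finset.card_range, nsmul_eq_mul,
    Finset.sum_range_sub (fun i => y (shift^[i] ⁻¹' A))]
  rfl

lemma eq_zero_of_map_shift_eq_of_coboundary {x y : SignedMeasure (ℕ → β)} (hx : x.map shift = x)
    (hy : x = y.map shift - y) : x = 0 := by
  ext A hA
  by_contra hne
  have hpos : 0 < |x A| := abs_pos.2 hne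
  obtain ⟨n, hn⟩ := exists_nat_gt (2 * y.totalVariation.real Set.univ / |x A|)
  have h := sum_apply_preimage_shift_iterate (p := 0) (y := -y) hx
    (by ext B hB; simp [hy, VectorMeasure.map_apply _ measurable_shift hB]) hA n
  have h₁ := abs_signedMeasure_le y (shift^[n] ⁻¹' A)
  have h₂ := abs_signedMeasure_le y A
  have h₃ : (n : ℝ) * x A = y (shift^[n] ⁻¹' A) - y A := by
    simp at h
    linarith
  have h₄ : (n : ℝ) * |x A| = |y (shift^[n] ⁻¹' A) - y A| := by
    rw [← h₃, abs_mul, Nat.abs_cast]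
  have h₅ := abs_sub (y (shift^[n] ⁻¹' A)) (y A)
  rw [div_lt_iff₀ hpos] at hn
  linarith

lemma exists_fixed_add_coboundary_of_finiteEvolutionDimension (p : SignedMeasure (ℕ → β))
    (hfin : FiniteDimensional ℝ
      (Submodule.span ℝ (Set.range fun k : ℕ => p.map (shift^[k])))) :
    ∃ x y : SignedMeasure (ℕ → β), x.map shift = x ∧ p = x + (y.map shift - y) := by
  set W := Submodule.span ℝ (Set.range fun k : ℕ => p.map (shift^[k]))
  have hW : ∀ s ∈ W, VectorMeasure.mapₗ (R := ℝ) shift s ∈ W := by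
    intro s hs
    have : W ≤ W.comap (VectorMeasure.mapₗ (R := ℝ) shift) := by
      refine Submodule.span_le.2 ?_
      rintro _ ⟨k, rfl⟩
      exact Submodule.subset_span ⟨k + 1, (signedMeasure_map_shift_iterate_succ p k).symm⟩
    exact this hs
  have hpW : p ∈ W := Submodule.subset_span ⟨0, VectorMeasure.map_id p⟩
  obtain ⟨x, y, hx, hp⟩ := LinearMap.exists_fixed_add_coboundary
    ((VectorMeasure.mapₗ (R := ℝ) shift).restrict hW)
    (fun x y hx hy => Subtype.ext <| eq_zero_of_map_shift_eq_of_coboundary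
      (congrArg Subtype.val hx) (congrArg Subtype.val hy)) ⟨p, hpW⟩
  exact ⟨x, y, congrArg Subtype.val hx, congrArg Subtype.val hp⟩

/-- A measure of finite evolution dimension has a stationary mean, and its Cesàro averages differ
from it by a coboundary divided by `n`. -/
lemma exists_stationaryMean (P : Measure (ℕ → β)) [IsProbabilityMeasure P]
    (hfin : FiniteDimensional ℝ
      (Submodule.span ℝ (Set.range fun k : ℕ => (P.toSignedMeasure).map (shift^[k])))) :
    ∃ (Q : Measure (ℕ → β)) (y : SignedMeasure (ℕ → β)), IsProbabilityMeasure Q ∧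
      Q.map shift = Q ∧ ∀ n : ℕ, n ≠ 0 → ∀ A, MeasurableSet A →
        (n : ℝ)⁻¹ * ∑ i ∈ Finset.range n, P.real (shift^[i] ⁻¹' A) - Q.real A =
          (n : ℝ)⁻¹ * (y (shift^[n] ⁻¹' A) - y A) := by
  obtain ⟨x, y, hx, hp⟩ := exists_fixed_add_coboundary_of_finiteEvolutionDimension _ hfin
  have havg : ∀ n : ℕ, n ≠ 0 → ∀ A, MeasurableSet A →
      (n : ℝ)⁻¹ * ∑ i ∈ Finset.range n, P.real (shift^[i] ⁻¹' A) - x A =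
        (n : ℝ)⁻¹ * (y (shift^[n] ⁻¹' A) - y A) := by
    intro n hn A hA
    have hn' : (n : ℝ) ≠ 0 := by exact_mod_cast hn
    have h := sum_apply_preimage_shift_iterate hx hp hA n
    simp only [Measure.toSignedMeasure_apply_measurable (measurable_shift_iterate _ hA)] at h
    rw [h]
    field_simp
    ring
  have hnonneg : ∀ A, MeasurableSet A → 0 ≤ x A := by
    intro A hA
    by_contra! hneg
    obtain ⟨n, hn⟩ := exists_nat_gt (2 * y.totalVariation.real Set.univ / -x A)
    have hn0 : n ≠ 0 := by
      rintro rfl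
      refine hn.not_ge ?_
      rw [Nat.cast_zero]
      exact div_nonneg (by positivity) (by linarith)
    have hn' : (0 : ℝ) < n := by positivity
    have h := havg n hn0 A hA
    have h₀ : 0 ≤ (n : ℝ)⁻¹ * ∑ i ∈ Finset.range n, P.real (shift^[i] ⁻¹' A) := by positivity
    have h₁ := abs_le.1 (abs_signedMeasure_le y (shift^[n] ⁻¹' A))
    have h₂ := abs_le.1 (abs_signedMeasure_le y A)
    have h₃ : (n : ℝ) * -x A ≤ y (shift^[n] ⁻¹' A) - y A := by
      rw [← le_inv_mul_iff₀ hn']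
      linarith
    rw [div_lt_iff₀ (by linarith)] at hn
    linarith
  have hx0 : VectorMeasure.restrict 0 Set.univ ≤ VectorMeasure.restrict x Set.univ :=
    VectorMeasure.restrict_le_restrict_of_subset_le _ _ fun A hA _ => by simpa using hnonneg A hA
  set Q := x.toMeasureOfZeroLE Set.univ MeasurableSet.univ hx0
  have hQ : ∀ A, MeasurableSet A → Q.real A = x A := fun A hA => by
    simpa using x.toMeasureOfZeroLE_real_apply hx0 MeasurableSet.univ hA
  refine ⟨Q, y, ⟨?_⟩, ?_, fun n hn A hA => by rw [hQ A hA, havg n hn A hA]⟩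
  · have h := havg 1 one_ne_zero Set.univ MeasurableSet.univ
    have h' : Q.real Set.univ = 1 := by
      rw [hQ _ MeasurableSet.univ]
      simp at h
      linarith
    rw [← ENNReal.toReal_eq_one_iff]
    exact h'
  · ext A hA
    rw [Measure.map_apply measurable_shift hA, ← measureReal_eq_measureReal_iff,
      hQ _ hA, hQ _ (measurable_shift hA)]
    exact signedMeasure_preimage_shift_iterate hx hA 1

end StationaryMean

section EntropyRate

open Real

variable {β : Type*} [Fintype β] [MeasurableSpace β] [DiscreteMeasurableSpace β]

lemma sum_abs_signedMeasure_preimage_cylinder_le (y : SignedMeasure (ℕ → β)) (k t : ℕ) :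
    ∑ v : Fin t → β, |y (shift^[k] ⁻¹' cylinder t v)| ≤ y.totalVariation.real Set.univ :=
  (Finset.sum_le_sum fun _ _ => y.norm_le_totalVariation _).trans_eq
    (sum_measureReal_preimage_cylinder _ k t)

lemma abs_wordEntropy_sub_le {P Q : Measure (ℕ → β)} [IsProbabilityMeasure P]
    [IsProbabilityMeasure Q] {y : SignedMeasure (ℕ → β)} {n : ℕ} (hn : n ≠ 0)
    (hQ : ∀ A, MeasurableSet A →
      (n : ℝ)⁻¹ * ∑ i ∈ Finset.range n, P.real (shift^[i] ⁻¹' A) - Q.real A =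
        (n : ℝ)⁻¹ * (y (shift^[n] ⁻¹' A) - y A)) (t : ℕ) :
    |wordEntropy P t - wordEntropy Q t| ≤ (n * log (Fintype.card β) + log n + 1) +
      2 * y.totalVariation.real Set.univ * log (Fintype.card β) / n * t := by
  have hn' : (0 : ℝ) < n := by positivity
  set q : (Fin t → β) → ℝ := fun v =>
    (n : ℝ)⁻¹ * ∑ i ∈ Finset.range n, wordProb (P.map shift^[i]) v with hq
  have hq01 : ∀ v, q v ∈ Set.Icc (0 : ℝ) 1 := by
    refine fun v => ⟨mul_nonneg (by positivity)
      (Finset.sum_nonneg fun i _ => (wordProb_mem_Icc _ v).1), ?_⟩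
    rw [hq, inv_mul_le_iff₀ hn']
    refine (Finset.sum_le_card_nsmul _ _ 1 fun i _ => (wordProb_mem_Icc _ v).2).trans ?_
    simp
  have hsum : ∑ v, |q v - wordProb Q v| ≤ 2 * y.totalVariation.real Set.univ / n := by
    have hterm : ∀ v, |q v - wordProb Q v| ≤
        (n : ℝ)⁻¹ * (|y (shift^[n] ⁻¹' cylinder t v)| + |y (shift^[0] ⁻¹' cylinder t v)|) := by
      intro v
      have : q v - wordProb Q v =
          (n : ℝ)⁻¹ * (y (shift^[n] ⁻¹' cylinder t v) - y (cylinder t v)) := by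
        simp only [hq, wordProb_map_shift]
        exact hQ _ (measurableSet_wordCylinder v)
      rw [this, abs_mul, abs_of_pos (inv_pos.2 hn')]
      exact mul_le_mul_of_nonneg_left (abs_sub _ _) (by positivity)
    refine (Finset.sum_le_sum fun v _ => hterm v).trans ?_
    rw [← Finset.mul_sum, Finset.sum_add_distrib, div_eq_inv_mul, two_mul]
    gcongr <;> exact sum_abs_signedMeasure_preimage_cylinder_le y _ t
  have h₁ := abs_sum_negMulLog_average_sub_wordEntropy_le P hn t
  have h₂ := abs_sum_negMulLog_sub_le hq01 (wordProb_mem_Icc Q)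
  rw [log_card_words] at h₂
  have h₃ : (∑ v, |q v - wordProb Q v|) * (t * log (Fintype.card β)) ≤
      2 * y.totalVariation.real Set.univ / n * (t * log (Fintype.card β)) :=
    mul_le_mul_of_nonneg_right hsum (mul_nonneg (by positivity) (log_natCast_nonneg _))
  have h₄ : 2 * y.totalVariation.real Set.univ / n * (t * log (Fintype.card β)) =
      2 * y.totalVariation.real Set.univ * log (Fintype.card β) / n * t := by ring
  change |_ - wordEntropy Q t| ≤ _ at h₂
  rw [abs_le] at *
  constructor <;> linarith

lemma tendsto_of_forall_abs_sub_le {a b : ℕ → ℝ} {L D : ℝ} {K : ℕ → ℝ}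
    (hb : Tendsto b atTop (nhds L))
    (h : ∀ n : ℕ, n ≠ 0 → ∀ t : ℕ, t ≠ 0 → |a t - b t| ≤ K n / t + D / n) :
    Tendsto a atTop (nhds L) := by
  have hdiff : Tendsto (fun t => a t - b t) atTop (nhds 0) := by
    rw [Metric.tendsto_atTop']
    intro ε hε
    obtain ⟨n, hDn, hn⟩ := (((tendsto_const_div_atTop_nhds_zero_nat D).eventually
      (gt_mem_nhds (half_pos hε))).and (eventually_ne_atTop 0)).exists
    obtain ⟨N, hN⟩ := eventually_atTop.1 (((tendsto_const_div_atTop_nhds_zero_nat (K n)).eventually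
      (gt_mem_nhds (half_pos hε))).and (eventually_ne_atTop 0))
    refine ⟨N, fun t ht => ?_⟩
    have hKt := hN t ht.le
    rw [Real.dist_eq, sub_zero]
    linarith [h n hn t hKt.2]
  simpa using hdiff.add hb

lemma tendsto_Hn_of_stationaryMean {P Q : Measure (ℕ → β)} [IsProbabilityMeasure P]
    [IsProbabilityMeasure Q] {y : SignedMeasure (ℕ → β)}
    (hQ : ∀ n : ℕ, n ≠ 0 → ∀ A, MeasurableSet A →
      (n : ℝ)⁻¹ * ∑ i ∈ Finset.range n, P.real (shift^[i] ⁻¹' A) - Q.real A =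
        (n : ℝ)⁻¹ * (y (shift^[n] ⁻¹' A) - y A))
    {L : ℝ} (hL : Tendsto (Hn Q) atTop (nhds L)) : Tendsto (Hn P) atTop (nhds L) := by
  refine tendsto_of_forall_abs_sub_le (K := fun n => n * log (Fintype.card β) + log n + 1)
    (D := 2 * y.totalVariation.real Set.univ * log (Fintype.card β)) hL fun n hn t ht => ?_
  have ht' : (0 : ℝ) < t := by positivity
  rw [Hn_eq_wordEntropy_div, Hn_eq_wordEntropy_div, ← sub_div, abs_div, Nat.abs_cast,
    div_le_iff₀ ht', add_mul, div_mul_cancel₀ _ ht'.ne']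
  exact abs_wordEntropy_sub_le hn (hQ n hn) t

end EntropyRate

lemma cesaroAvgS_apply {β : Type*} [MeasurableSpace β] (P : Measure (ℕ → β)) [IsFiniteMeasure P]
    (n : ℕ) {A : Set (ℕ → β)} (hA : MeasurableSet A) :
    cesaroAvgS P n A = (n : ℝ)⁻¹ * ∑ i ∈ Finset.range n, P.real (shift^[i] ⁻¹' A) := by
  have hsum : ∀ s : Finset ℕ, (∑ i ∈ s, P.toSignedMeasure.map shift^[i]) A =
      ∑ i ∈ s, P.real (shift^[i] ⁻¹' A) := by
    intro s
    induction s using Finset.induction_on with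
    | empty => simp
    | insert i s hi ih =>
      rw [Finset.sum_insert hi, Finset.sum_insert hi, add_apply, ih,
        VectorMeasure.map_apply _ (measurable_shift_iterate i) hA,
        Measure.toSignedMeasure_apply_measurable (measurable_shift_iterate i hA)]
  rw [cesaroAvgS, smul_apply, hsum, smul_eq_mul]

lemma stationaryMean_unique {β : Type*} [MeasurableSpace β] {P Q R : Measure (ℕ → β)}
    [IsProbabilityMeasure P] [IsProbabilityMeasure Q] [IsProbabilityMeasure R]
    {y : SignedMeasure (ℕ → β)}
    (hQ : ∀ n : ℕ, n ≠ 0 → ∀ A, MeasurableSet A →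
      (n : ℝ)⁻¹ * ∑ i ∈ Finset.range n, P.real (shift^[i] ⁻¹' A) - Q.real A =
        (n : ℝ)⁻¹ * (y (shift^[n] ⁻¹' A) - y A))
    (hR : Tendsto (fun n : ℕ => (SignedMeasure.totalVariation
      (cesaroAvgS P n - R.toSignedMeasure) Set.univ).toReal) atTop (nhds 0)) : R = Q := by
  ext A hA
  rw [← measureReal_eq_measureReal_iff]
  have h₁ : Tendsto (fun n : ℕ => cesaroAvgS P n A - R.real A) atTop (nhds 0) := by
    refine squeeze_zero_norm (fun n => ?_) hR
    have := abs_signedMeasure_le (cesaroAvgS P n - R.toSignedMeasure) A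
    rwa [sub_apply, Measure.toSignedMeasure_apply_measurable hA] at this
  have h₂ : Tendsto (fun n : ℕ => cesaroAvgS P n A - Q.real A) atTop (nhds 0) := by
    refine squeeze_zero_norm' ?_
      (tendsto_const_div_atTop_nhds_zero_nat (2 * y.totalVariation.real Set.univ))
    filter_upwards [eventually_ne_atTop 0] with n hn
    rw [cesaroAvgS_apply P n hA, hQ n hn A hA, norm_mul, norm_inv, Real.norm_natCast,
      div_eq_inv_mul, two_mul]
    gcongr
    exact (abs_sub _ _).trans (add_le_add (abs_signedMeasure_le _ _) (abs_signedMeasure_le _ _))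
  have h₃ := h₁.sub h₂
  simp only [sub_sub_sub_cancel_left, sub_zero] at h₃
  linarith [tendsto_nhds_unique h₃ tendsto_const_nhds]

/-- Theorem 3 (Existence of entropy rate): if `P` has finite evolution dimension
(the span of the pushforwards `P ∘ T^{−k}`, `k ∈ ℕ`, in the space of finite signed
measures is finite-dimensional), then `H̄(P) = H̲(P)`, i.e. the entropy rate
`H(P) = lim_t H^t(P)` exists; moreover, for any stationary mean `P̄` of `P`
(a shift-invariant probability measure with `‖P_n − P̄‖_TV → 0`) one has
`H(P) = lim_t H^t(P̄)`. -/
theorem entropyRate_exists_of_finiteEvolutionDimension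
    (P : Measure (ℕ → α)) [IsProbabilityMeasure P]
    (hfin : FiniteDimensional ℝ
      (Submodule.span ℝ (Set.range fun k : ℕ => (P.toSignedMeasure).map (shift^[k])))) :
    limsup (Hn P) atTop = liminf (Hn P) atTop ∧
    ∃ L : ℝ, Tendsto (Hn P) atTop (nhds L) ∧
      ∀ (Pbar : Measure (ℕ → α)) [IsProbabilityMeasure Pbar],
        Pbar.map shift = Pbar →
        Tendsto
          (fun n : ℕ => (SignedMeasure.totalVariation
            (cesaroAvgS P n - Pbar.toSignedMeasure) Set.univ).toReal)
          atTop (nhds 0) →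
        Tendsto (Hn Pbar) atTop (nhds L) := by
  obtain ⟨Q, y, _, hQ, havg⟩ := exists_stationaryMean P hfin
  obtain ⟨L, hL⟩ := exists_tendsto_Hn_of_map_shift_eq Q hQ
  have hP := tendsto_Hn_of_stationaryMean havg hL
  refine ⟨hP.limsup_eq.trans hP.liminf_eq.symm, L, hP, fun R _ _ hR => ?_⟩
  rwa [stationaryMean_unique havg hR]
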